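/- Let V be a Jordan triple system, let w ∈ V be a maximal tripotent, and let v ∈ V be a tripotent with D(w,w)v = v/2. Set w_v = 2{v,v,w}. Then {w−w_v, w−w_v, v} = 0; consequently v is orthogonal to the tripotent w − w_v. -/

import Mathlib

/-- A Jordan triple system: a complex vector space with a triple product
symmetric and linear in the outer variables, conjugate-linear in the middle
variable, satisfying the Jordan triple (main) identity. -/
structure JordanTriple (V : Type*) [AddCommGroup V] [Module ℂ V] where
  tp : V → V → V → V
  symm_outer : ∀ a b c, tp a b c = tp c b a
  add_fst : ∀ a a' b c, tp (a + a') b c = tp a b c + tp a' b c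
  smul_fst : ∀ (r : ℂ) (a b c : V), tp (r • a) b c = r • tp a b c
  add_snd : ∀ a b b' c, tp a (b + b') c = tp a b c + tp a b' c
  smul_snd : ∀ (r : ℂ) (a b c : V), tp a (r • b) c = (starRingEnd ℂ r) • tp a b c
  jordan_identity : ∀ a b x y z,
    tp a b (tp x y z) = tp (tp a b x) y z - tp x (tp b a y) z + tp x y (tp a b z)

namespace JordanTriple

variable {V : Type*} [AddCommGroup V] [Module ℂ V]

/-- A tripotent: `{e,e,e} = e`. -/
def IsTripotent (T : JordanTriple V) (e : V) : Prop := T.tp e e e = e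

/-- Orthogonality of elements: `D(x,y) = 0` and `D(y,x) = 0`. -/
def Orthogonal (T : JordanTriple V) (x y : V) : Prop :=
  (∀ z, T.tp x y z = 0) ∧ (∀ z, T.tp y x z = 0)

/-- A maximal (complete) tripotent: the Peirce projection
`P₀(w) = I - 2 D(w,w) + Q(w)²` vanishes on `V`. -/
def IsMaximalTripotent (T : JordanTriple V) (w : V) : Prop :=
  T.IsTripotent w ∧ ∀ z : V, z - (2 : ℂ) • T.tp w w z + T.tp w (T.tp w z w) w = 0

/-- Orthogonality is symmetric: `D(a,a)b = 0` implies `D(b,b)a = 0`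
(true in every JB*-triple). -/
def OrthSymm (T : JordanTriple V) : Prop :=
  ∀ a b : V, T.tp a a b = 0 → T.tp b b a = 0

end JordanTriple

variable {V : Type*} [AddCommGroup V] [Module ℂ V]

open JordanTriple

namespace JordanTriple

section Lemmas

variable {V : Type*} [AddCommGroup V] [Module ℂ V] (T : JordanTriple V)

theorem tp_zero_fst (b c : V) : T.tp 0 b c = 0 := by
  simpa using T.smul_fst 0 0 b c

theorem tp_zero_snd (a c : V) : T.tp a 0 c = 0 := by
  simpa using T.smul_snd 0 a 0 c

theorem tp_zero_trd (a b : V) : T.tp a b 0 = 0 := by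
  rw [T.symm_outer, T.tp_zero_fst]

theorem tp_smul_trd (r : ℂ) (a b c : V) : T.tp a b (r • c) = r • T.tp a b c := by
  rw [T.symm_outer, T.smul_fst, T.symm_outer]

theorem tp_sub_trd (a b c d : V) : T.tp a b (c - d) = T.tp a b c - T.tp a b d := by
  have h := T.add_fst (c - d) d b a
  rw [sub_add_cancel] at h
  rw [T.symm_outer a b (c - d), T.symm_outer a b c, T.symm_outer a b d, h, add_sub_cancel_right]

variable {T}

theorem IsTripotent.quadratic_eq_zero {e x : V} (he : T.IsTripotent e) (hx : T.tp e e x = 0) :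
    T.tp e x e = 0 := by
  have hx' : T.tp x e e = 0 := by rw [T.symm_outer, hx]
  have h := T.jordan_identity e x e e e
  have h' := T.jordan_identity e e e x e
  rw [T.symm_outer (T.tp e x e) e e, he, hx', T.tp_zero_snd] at h
  rw [he, hx, T.tp_zero_snd] at h'
  rw [h'] at h
  have h3 : (3 : ℂ) • T.tp e x e = 0 := by
    linear_combination (norm := module) -h
  simpa using h3

theorem IsTripotent.tp_self_right_eq_zero {e x : V} (he : T.IsTripotent e)
    (hx : T.tp e e x = 0) : T.tp x x e = 0 := by
  have hx' : T.tp x e e = 0 := by rw [T.symm_outer, hx]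
  have h := T.jordan_identity e x e e x
  have h' := T.jordan_identity e e e x x
  rw [hx, hx', he.quadratic_eq_zero hx, T.tp_zero_trd, T.tp_zero_fst, T.tp_zero_snd, sub_zero,
    zero_add] at h
  rw [he, hx, T.tp_zero_snd, T.tp_zero_trd, sub_zero, add_zero, ← h] at h'
  rw [T.symm_outer, ← h']

theorem IsMaximalTripotent.eq_zero {w y : V} (hw : T.IsMaximalTripotent w)
    (hy : T.tp w w y = 0) : y = 0 := by
  simpa [hy, hw.1.quadratic_eq_zero hy, T.tp_zero_snd] using hw.2 y

theorem IsMaximalTripotent.quadratic_eq_zero {w v : V} (hw : T.IsMaximalTripotent w)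
    (h1 : T.tp w w v = (1 / 2 : ℂ) • v) : T.tp v w v = 0 := by
  apply hw.eq_zero
  rw [T.jordan_identity, hw.1, h1, T.smul_fst, T.tp_smul_trd]
  module

theorem IsTripotent.tp_sub_eq_zero {e w : V} (he : T.IsTripotent e) (hw : T.tp e w e = 0) :
    T.tp e e (w - (2 : ℂ) • T.tp e e w) = 0 := by
  have h := T.jordan_identity w e e e e
  rw [he, hw, T.tp_zero_snd, sub_zero, T.symm_outer (T.tp w e e), T.symm_outer w] at h
  rw [T.tp_sub_trd, T.tp_smul_trd, two_smul, ← h, sub_self]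

end Lemmas

end JordanTriple

/-- If `w` is a maximal tripotent and `v` is a tripotent with `D(w,w)v = v/2`,
then with `w_v = 2{v,v,w}` one has `{w - w_v, w - w_v, v} = 0`. -/
theorem v_orth_w_sub_wv (T : JordanTriple V) (w v : V)
    (hw : T.IsMaximalTripotent w) (hv : T.IsTripotent v)
    (h1 : T.tp w w v = (1/2 : ℂ) • v)
    (wv : V) (hwv : wv = (2 : ℂ) • T.tp v v w) :
    T.tp (w - wv) (w - wv) v = 0 := by
  subst hwv
  exact hv.tp_self_right_eq_zero (hv.tp_sub_eq_zero (hw.quadratic_eq_zero h1))
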